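/- Let 0 < k ≤ n be an integer and s_1, ..., s_k ∈ J(n,q). If P ∈ F[x_1,...,x_n] satisfies P(s_j) ≠ 0 for each j = 1,...,k and P(w) = 0 for all w ∈ J(n,q) \ {s_1,...,s_k}, then deg(P) ≥ q − 1. -/

import Mathlib

open MvPolynomial in
theorem aux_deg {F : Type*} [Field F] {σ τ : Type*} (g : σ → MvPolynomial τ F)
    (hg : ∀ j, (g j).totalDegree ≤ 1) (P : MvPolynomial σ F) :
    (aeval g P).totalDegree ≤ P.totalDegree := by
  rw [aeval_def, eval₂_eq]
  apply totalDegree_finsetSum_le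
  intro d hd
  refine (totalDegree_mul _ _).trans ?_
  rw [MvPolynomial.algebraMap_eq, totalDegree_C, zero_add]
  refine (totalDegree_finsetProd _ _).trans ?_
  refine le_trans ?_ (le_totalDegree hd)
  apply Finset.sum_le_sum
  intro j _
  refine (totalDegree_pow _ _).trans ?_
  calc d j * (g j).totalDegree ≤ d j * 1 := Nat.mul_le_mul_left _ (hg j)
    _ = d j := mul_one _

open MvPolynomial in
theorem aux_unisolvent {F : Type*} [Field F] (n : ℕ) : ∀ (q : ℕ) (i : Fin q → F)
    (_ : Function.Injective i) (P : MvPolynomial (Fin n) F) (_ : P.totalDegree < q)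
    (_ : ∀ w : Fin n → Fin q, Monotone w → eval (fun j => i (w j)) P = 0), P = 0 := by
  induction n with
  | zero =>
    intro q i hi P hP h
    have h1 := h (fun j => j.elim0) (fun j => j.elim0)
    rw [eq_C_of_isEmpty P] at h1 ⊢
    rw [eval_C] at h1
    rw [h1, C_0]
  | succ n ihn =>
    intro q
    induction q with
    | zero => intro i hi P hP; omega
    | succ q ihq =>
      intro i hi P hP h
      set g : Fin (n+1) → MvPolynomial (Fin n) F := Fin.cases (C (i 0)) X with hg
      have hR : aeval g P = 0 := by
        apply ihn (q+1) i hi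
        · refine (aux_deg g ?_ P).trans_lt hP
          intro j
          refine Fin.cases ?_ (fun j => ?_) j
          · simp [hg]
          · simp [hg]
        · intro w hw
          have := h (Fin.cons 0 w) ?_
          · rw [← this, aeval_def, MvPolynomial.algebraMap_eq]
            rw [← coe_aeval_eq_eval, ← coe_aeval_eq_eval]
            change (aeval fun j => i (w j)) (aeval g P) = aeval _ P
            rw [← AlgHom.comp_apply]
            congr 1
            apply algHom_ext
            intro j
            refine Fin.cases ?_ (fun j => ?_) j
            · simp [hg]
            · simp [hg]
          · intro a b hab
            revert hab
            refine Fin.cases ?_ (fun a => ?_) a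
            · intro _; simp
            · refine Fin.cases ?_ (fun b => ?_) b
              · intro h; simp at h
              · intro h; simpa using hw (by simpa using h)
      have hroot : (finSuccEquiv F n P).eval (C (i 0)) = 0 := by
        rw [← hR, ← Polynomial.coe_aeval_eq_eval]
        change ((Polynomial.aeval (C (i 0))).restrictScalars F) ((finSuccEquiv F n).toAlgHom P) = _
        rw [← AlgHom.comp_apply]
        congr 1
        apply algHom_ext
        intro j
        refine Fin.cases ?_ (fun j => ?_) j
        · simp [hg, finSuccEquiv_X_zero]
        · simp [hg, finSuccEquiv_X_succ]
      obtain ⟨G, hG⟩ := Polynomial.dvd_iff_isRoot.mpr hroot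
      obtain ⟨Q, rfl⟩ := (finSuccEquiv F n).surjective G
      have hPQ : P = (X 0 - C (i 0)) * Q := by
        apply (finSuccEquiv F n).injective
        rw [hG, map_mul, map_sub, finSuccEquiv_X_zero]
        congr 2
        simp [finSuccEquiv_apply]
      have hL : 1 ≤ (X 0 - C (i 0) : MvPolynomial (Fin (n+1)) F).totalDegree := by
        have : Finsupp.single 0 1 ∈ (X 0 - C (i 0) : MvPolynomial (Fin (n+1)) F).support := by
          rw [mem_support_iff, coeff_sub, coeff_X, coeff_C, if_pos rfl, if_neg]
          · simp
          · intro h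
            have := DFunLike.congr_fun h 0
            simp at this
        have := le_totalDegree this
        simpa using this
      have hL0 : (X 0 - C (i 0) : MvPolynomial (Fin (n+1)) F) ≠ 0 := by
        intro h0; rw [h0] at hL; simp at hL
      have hQ : Q = 0 := by
        by_contra hQ
        apply hQ
        apply ihq (i ∘ Fin.succ) (hi.comp (Fin.succ_injective _))
        · rw [hPQ, totalDegree_mul_of_isDomain hL0 hQ] at hP
          omega
        · intro w hw
          have := h (fun j => (w j).succ) (fun a b hab => by simpa using hw hab)
          rw [hPQ, map_mul] at this
          rcases mul_eq_zero.mp this with h1 | h1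
          · exfalso
            simp only [map_sub, eval_X, eval_C, sub_eq_zero] at h1
            exact Fin.succ_ne_zero _ (hi h1)
          · exact h1
      rw [hPQ, hQ, mul_zero]

open MvPolynomial in
theorem aux_hyper {F : Type*} [Field F] (n k : ℕ) (hkn : k ≤ n) (p : Fin k → Fin n → F) :
    ∃ L : MvPolynomial (Fin n) F, L ≠ 0 ∧ L.totalDegree ≤ 1 ∧ ∀ r, eval (p r) L = 0 := by
  let M : Matrix (Fin k) (Option (Fin n)) F := fun r o => o.elim 1 (p r)
  have hker : LinearMap.ker (Matrix.mulVecLin M) ≠ ⊥ := by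
    apply LinearMap.ker_ne_bot_of_finrank_lt
    simp; omega
  obtain ⟨c, hc, hc0⟩ := Submodule.exists_mem_ne_zero_of_ne_bot hker
  have hev : ∀ x : Fin n → F, eval x (C (c none) + ∑ j, C (c (some j)) * X j)
      = c none + ∑ j, c (some j) * x j := by
    intro x; simp
  refine ⟨C (c none) + ∑ j, C (c (some j)) * X j, ?_, ?_, ?_⟩
  · intro h
    rw [h] at hev
    have h0 : c none = 0 := by simpa using (hev 0).symm
    apply hc0
    funext o
    cases o with
    | none => exact h0
    | some j => simpa [h0, Pi.single_apply] using (hev (Pi.single j 1)).symm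
  · refine (totalDegree_add _ _).trans (max_le (by simp) ?_)
    apply totalDegree_finsetSum_le
    intro j _
    refine (totalDegree_mul _ _).trans (by simp)
  · intro r
    rw [hev]
    have : ∑ o, M r o * c o = 0 := congrFun (LinearMap.mem_ker.mp hc) r
    simp only [Fintype.sum_option, M] at this
    simpa [mul_comm] using this


theorem stmt_11 {F : Type*} [Field F] (n q k : ℕ) (hn : 1 ≤ n) (hq : 1 ≤ q)
    (hk : 0 < k) (hkn : k ≤ n)
    (i : Fin q → F) (hi : Function.Injective i)
    (s : Fin k → (Fin n → Fin q)) (hs : ∀ r, Monotone (s r))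
    (P : MvPolynomial (Fin n) F)
    (hP1 : ∀ r, MvPolynomial.eval (fun j => i (s r j)) P ≠ 0)
    (hP0 : ∀ w : Fin n → Fin q, Monotone w → (∀ r, w ≠ s r) →
      MvPolynomial.eval (fun j => i (w j)) P = 0) :
    q - 1 ≤ P.totalDegree := by
  by_contra hlt
  obtain ⟨L, hL0, hL1, hL⟩ := aux_hyper n k hkn (fun r j => i (s r j))
  have hz : L * P = 0 := by
    apply aux_unisolvent n q i hi
    · have := MvPolynomial.totalDegree_mul L P
      omega
    · intro w hw
      rw [map_mul]
      by_cases h : ∀ r, w ≠ s r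
      · rw [hP0 w hw h, mul_zero]
      · push Not at h
        obtain ⟨r, rfl⟩ := h
        rw [hL r, zero_mul]
  rcases mul_eq_zero.mp hz with h | h
  · exact hL0 h
  · exact hP1 ⟨0, hk⟩ (by rw [h, map_zero])
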